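/- arXiv:math/0212085 — 5 statements merged into one kernel-verified Lean document; each statement's English description precedes it below -/
import Mathlib

section
/- Let ν₁ ≥ ν₂ ≥ 0 and β₁, β₂ ≥ 0 be integers such that β₁' := β₁ + ν₁ − ν₂ and β₂' := β₂ + ν₁ − ν₂ are both even. Then the following are equivalent: (i) there exist nonnegative integers α₁, α₂, γ with β₁ = α₁ + γ, β₂ = α₂ + γ and α₁ + α₂ = 2ν₂; (ii) both triples (β₁'/2, β₂'/2, ν₁) and (β₁'/2, β₂'/2, ν₂) are balanced, i.e., in each triple every entry is less than or equal to the sum of the other two entries. -/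
/-- A triple `(a, b, c)` of integers is *balanced* if each entry is at most the
sum of the other two (the triangle inequality). -/
def BalancedTriple (a b c : ℤ) : Prop := a ≤ b + c ∧ b ≤ a + c ∧ c ≤ a + b

/-- Let `ν₁ ≥ ν₂ ≥ 0` and `β₁, β₂ ≥ 0` be integers such that
`β₁' = β₁ + ν₁ - ν₂` and `β₂' = β₂ + ν₁ - ν₂` are both even.  Then there exist
nonnegative integers `α₁, α₂, γ` with `β₁ = α₁ + γ`, `β₂ = α₂ + γ` and
`α₁ + α₂ = 2ν₂` if and only if both triples `(β₁'/2, β₂'/2, ν₁)` and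
`(β₁'/2, β₂'/2, ν₂)` are balanced. -/
theorem stmt0 (ν₁ ν₂ β₁ β₂ : ℤ) (hν : ν₂ ≤ ν₁) (hν₂ : 0 ≤ ν₂)
    (hβ₁ : 0 ≤ β₁) (hβ₂ : 0 ≤ β₂)
    (he₁ : Even (β₁ + ν₁ - ν₂)) (he₂ : Even (β₂ + ν₁ - ν₂)) :
    (∃ α₁ α₂ γ : ℤ, 0 ≤ α₁ ∧ 0 ≤ α₂ ∧ 0 ≤ γ ∧
        β₁ = α₁ + γ ∧ β₂ = α₂ + γ ∧ α₁ + α₂ = 2 * ν₂) ↔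
      (BalancedTriple ((β₁ + ν₁ - ν₂) / 2) ((β₂ + ν₁ - ν₂) / 2) ν₁ ∧
        BalancedTriple ((β₁ + ν₁ - ν₂) / 2) ((β₂ + ν₁ - ν₂) / 2) ν₂) := by
  obtain ⟨m, hm⟩ := he₁
  obtain ⟨n, hn⟩ := he₂
  unfold BalancedTriple
  constructor
  · rintro ⟨α₁, α₂, γ, h₁, h₂, h₃, h₄, h₅, h₆⟩
    omega
  · intro h
    refine ⟨m - n + ν₂, n - m + ν₂, m + n - ν₁, ?_⟩
    omega
end

section
/- For every γ ∈ SL₂(F), the matrix ι̃(γ) has all of its entries in ℚ and lies in the symplectic group Sp₄(ℚ); moreover the map γ ↦ ι̃(γ) is an injective group homomorphism from SL₂(F) into Sp₄(ℚ). -/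
open Matrix

noncomputable section

/-- The discriminant of `ℚ(√N)` for squarefree `N`: `Δ = N` if `N ≡ 1 mod 4`,
else `Δ = 4N`. -/
def discN (N : ℕ) : ℕ := if N % 4 = 1 then N else 4 * N

/-- `√Δ` as an element of `F = ℚ(α)` with `α² = N`: it is `α` if `N ≡ 1 mod 4`
and `2α` otherwise. -/
def sqrtDisc {F : Type*} [Field F] (N : ℕ) (α : F) : F :=
  if N % 4 = 1 then α else 2 * α

/-- The generator `w = (Δ + √Δ)/2` of the ring of integers `𝒪_F = ℤ + ℤw`. -/
def wQ {F : Type*} [Field F] (N : ℕ) (α : F) : F :=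
  ((discN N : F) + sqrtDisc N α) / 2

/-- The matrix `C` with rows `(1, 1)` and `(σ₁(w), σ₂(w))`. -/
def CmatQ {F : Type*} [Field F] (σ₁ σ₂ : F →+* ℝ) (N : ℕ) (α : F) :
    Matrix (Fin 2) (Fin 2) ℝ :=
  !![1, 1; σ₁ (wQ N α), σ₂ (wQ N α)]

/-- The matrix `M(γ)` with rows `(σ₁(a),0,σ₁(b),0)`, `(0,σ₂(a),0,σ₂(b))`,
`(σ₁(c),0,σ₁(d),0)`, `(0,σ₂(c),0,σ₂(d))` for `γ = (a b; c d)`. -/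
def Mgam {F : Type*} [Field F] (σ₁ σ₂ : F →+* ℝ)
    (γ : Matrix (Fin 2) (Fin 2) F) : Matrix (Fin 4) (Fin 4) ℝ :=
  !![σ₁ (γ 0 0), 0, σ₁ (γ 0 1), 0;
     0, σ₂ (γ 0 0), 0, σ₂ (γ 0 1);
     σ₁ (γ 1 0), 0, σ₁ (γ 1 1), 0;
     0, σ₂ (γ 1 0), 0, σ₂ (γ 1 1)]

/-- The block diagonal matrix `diag(P, Q)` of size 4. -/
def blkDiag (P Q : Matrix (Fin 2) (Fin 2) ℝ) : Matrix (Fin 4) (Fin 4) ℝ :=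
  !![P 0 0, P 0 1, 0, 0;
     P 1 0, P 1 1, 0, 0;
     0, 0, Q 0 0, Q 0 1;
     0, 0, Q 1 0, Q 1 1]

/-- The embedding `ι̃(γ) = diag(C, ᵀC⁻¹) · M(γ) · diag(C⁻¹, ᵀC)`. -/
def iotaTilde {F : Type*} [Field F] (σ₁ σ₂ : F →+* ℝ) (N : ℕ) (α : F)
    (γ : Matrix (Fin 2) (Fin 2) F) : Matrix (Fin 4) (Fin 4) ℝ :=
  blkDiag (CmatQ σ₁ σ₂ N α) ((CmatQ σ₁ σ₂ N α)⁻¹)ᵀ * Mgam σ₁ σ₂ γ *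
    blkDiag (CmatQ σ₁ σ₂ N α)⁻¹ (CmatQ σ₁ σ₂ N α)ᵀ

/-- The standard symplectic form matrix `[[0, I₂], [-I₂, 0]]`. -/
def J4 : Matrix (Fin 4) (Fin 4) ℝ :=
  !![0, 0, 1, 0;
     0, 0, 0, 1;
     -1, 0, 0, 0;
     0, -1, 0, 0]

theorem blkDiag_mul (P Q P' Q' : Matrix (Fin 2) (Fin 2) ℝ) :
    blkDiag P Q * blkDiag P' Q' = blkDiag (P * P') (Q * Q') := by
  ext i j
  fin_cases i <;> fin_cases j <;> simp [blkDiag, Matrix.mul_apply, Fin.sum_univ_four]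

theorem blkDiag_one : blkDiag 1 1 = 1 := by
  ext i j
  fin_cases i <;> fin_cases j <;> simp [blkDiag]

theorem blkDiag_transpose_mul_J4_mul (P Q P' Q' : Matrix (Fin 2) (Fin 2) ℝ)
    (h : Pᵀ * Q' = 1) (h' : Qᵀ * P' = 1) :
    (blkDiag P Q)ᵀ * J4 * blkDiag P' Q' = J4 := by
  have e (i j) := congrFun (congrFun h i) j
  have e' (i j) := congrFun (congrFun h' i) j
  simp only [Matrix.mul_apply, Fin.sum_univ_two, Matrix.transpose_apply, Fin.forall_fin_two,
    Matrix.one_apply] at e e'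
  ext i j
  fin_cases i <;> fin_cases j <;>
    simp [blkDiag, J4, Matrix.mul_apply, Fin.sum_univ_four] <;>
    simp_all <;> linarith

section

variable {F : Type*} [Field F] (σ₁ σ₂ : F →+* ℝ)

theorem Mgam_mul (γ δ : Matrix (Fin 2) (Fin 2) F) :
    Mgam σ₁ σ₂ (γ * δ) = Mgam σ₁ σ₂ γ * Mgam σ₁ σ₂ δ := by
  ext i j
  fin_cases i <;> fin_cases j <;>
    simp [Mgam, Matrix.mul_apply, Fin.sum_univ_four, Fin.sum_univ_two]

theorem Mgam_injective : Function.Injective (Mgam σ₁ σ₂) := by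
  intro γ δ h
  have e (i j) := congrFun (congrFun h i) j
  ext i j
  apply σ₁.injective
  fin_cases i <;> fin_cases j
  · simpa [Mgam] using e 0 0
  · simpa [Mgam] using e 0 2
  · simpa [Mgam] using e 2 0
  · simpa [Mgam] using e 2 2

theorem Mgam_transpose_mul_J4_mul (γ : Matrix (Fin 2) (Fin 2) F) (hγ : γ.det = 1) :
    (Mgam σ₁ σ₂ γ)ᵀ * J4 * Mgam σ₁ σ₂ γ = J4 := by
  rw [Matrix.det_fin_two] at hγ
  have h₁ := congrArg σ₁ hγ
  have h₂ := congrArg σ₂ hγ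
  simp only [map_sub, map_mul, map_one] at h₁ h₂
  ext i j
  fin_cases i <;> fin_cases j <;>
    simp [Mgam, J4, Matrix.mul_apply, Fin.sum_univ_four] <;> linarith

variable {σ₁ σ₂} {N : ℕ} {α : F}

theorem sqrtDisc_ne_zero [CharZero F] (hα : α ≠ 0) : sqrtDisc N α ≠ 0 := by
  unfold sqrtDisc
  split_ifs <;> simp [hα]

theorem map_sqrtDisc_eq_neg (h : σ₂ α = -σ₁ α) :
    σ₂ (sqrtDisc N α) = -σ₁ (sqrtDisc N α) := by
  unfold sqrtDisc
  split_ifs <;> simp [h, map_ofNat]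

/-- The columns of `C⁻¹` are the conjugates of the trace-dual basis of `(1, w)`. -/
theorem CmatQ_mul_dual [CharZero F] (hα : α ≠ 0) (h : σ₂ α = -σ₁ α) :
    CmatQ σ₁ σ₂ N α *
      !![σ₁ (1 - wQ N α / sqrtDisc N α), σ₁ (1 / sqrtDisc N α);
         σ₂ (1 - wQ N α / sqrtDisc N α), σ₂ (1 / sqrtDisc N α)] = 1 := by
  have hd : σ₁ (sqrtDisc N α) ≠ 0 := (map_ne_zero σ₁).2 (sqrtDisc_ne_zero hα)
  have hd₂ := map_sqrtDisc_eq_neg (N := N) h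
  ext i j
  fin_cases i <;> fin_cases j <;>
    simp [CmatQ, wQ, Matrix.mul_apply, hd₂, map_ofNat] <;> field_simp <;> ring

theorem exists_rat_eq_map_add_map (h : σ₂ α = -σ₁ α)
    (hgen : ∀ x : F, ∃ p q : ℚ, x = (p : F) + (q : F) * α) (x : F) :
    ∃ q : ℚ, σ₁ x + σ₂ x = q := by
  obtain ⟨p, q, rfl⟩ := hgen x
  refine ⟨2 * p, ?_⟩
  simp [h]
  ring

theorem exists_rat_eq_iotaTilde [CharZero F] (hα : α ≠ 0) (h : σ₂ α = -σ₁ α)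
    (hgen : ∀ x : F, ∃ p q : ℚ, x = (p : F) + (q : F) * α)
    (γ : Matrix (Fin 2) (Fin 2) F) (i j : Fin 4) :
    ∃ q : ℚ, iotaTilde σ₁ σ₂ N α γ i j = q := by
  let w := wQ N α
  let f := 1 - wQ N α / sqrtDisc N α
  let g := 1 / sqrtDisc N α
  have hC : CmatQ σ₁ σ₂ N α = !![σ₁ 1, σ₂ 1; σ₁ w, σ₂ w] := by simp [CmatQ, w]
  have hC' : (CmatQ σ₁ σ₂ N α)⁻¹ = !![σ₁ f, σ₁ g; σ₂ f, σ₂ g] :=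
    Matrix.inv_eq_right_inv (CmatQ_mul_dual hα h)
  let l : Fin 4 → F := ![1, w, f, g]
  let r : Fin 4 → F := ![f, g, 1, w]
  let k : Fin 4 → Fin 2 := ![0, 0, 1, 1]
  have key : iotaTilde σ₁ σ₂ N α γ i j =
      σ₁ (l i * γ (k i) (k j) * r j) + σ₂ (l i * γ (k i) (k j) * r j) := by
    rw [iotaTilde, hC', hC]
    simp only [map_mul]
    fin_cases i <;> fin_cases j <;>
      simp [blkDiag, Mgam, Matrix.mul_apply, Fin.sum_univ_four, l, r, k]
  rw [key]
  exact exists_rat_eq_map_add_map h hgen _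

end

/-- For every `γ ∈ SL₂(F)` (where `F = ℚ(√N)`), the matrix `ι̃(γ)` has all of its
entries in `ℚ` and is symplectic (so it lies in `Sp₄(ℚ)`); moreover `γ ↦ ι̃(γ)` is
an injective group homomorphism from `SL₂(F)` into `Sp₄(ℚ)`. -/
theorem stmt8 {F : Type*} [Field F] [CharZero F] (N : ℕ) (hN : 1 < N)
    (hsf : Squarefree N) (α : F) (hα : α ^ 2 = (N : F))
    (hgen : ∀ x : F, ∃ p q : ℚ, x = (p : F) + (q : F) * α)
    (σ₁ σ₂ : F →+* ℝ) (hσ₁ : σ₁ α = Real.sqrt N) (hσ₂ : σ₂ α = -Real.sqrt N) :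
    (∀ γ : Matrix.SpecialLinearGroup (Fin 2) F,
      (∀ i j, ∃ q : ℚ, iotaTilde σ₁ σ₂ N α γ.1 i j = (q : ℝ)) ∧
      (iotaTilde σ₁ σ₂ N α γ.1)ᵀ * J4 * iotaTilde σ₁ σ₂ N α γ.1 = J4) ∧
    (∀ γ δ : Matrix.SpecialLinearGroup (Fin 2) F,
      iotaTilde σ₁ σ₂ N α (γ * δ).1 =
        iotaTilde σ₁ σ₂ N α γ.1 * iotaTilde σ₁ σ₂ N α δ.1) ∧
    Function.Injective
      (fun γ : Matrix.SpecialLinearGroup (Fin 2) F => iotaTilde σ₁ σ₂ N α γ.1) := by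
  have hs : Real.sqrt N ≠ 0 := (Real.sqrt_pos.2 (by exact_mod_cast (by omega : 0 < N))).ne'
  have hα₀ : α ≠ 0 := fun h0 => hs (by rw [← hσ₁, h0, map_zero])
  have h : σ₂ α = -σ₁ α := by rw [hσ₁, hσ₂]
  have hC := CmatQ_mul_dual (N := N) hα₀ h
  set C := CmatQ σ₁ σ₂ N α with hCdef
  have hu : IsUnit C.det := Matrix.isUnit_det_of_right_inverse hC
  have hCC : C * C⁻¹ = 1 := Matrix.mul_nonsing_inv C hu
  have hCC' : C⁻¹ * C = 1 := Matrix.nonsing_inv_mul C hu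
  have hT : Cᵀ * (C⁻¹)ᵀ = 1 := by rw [← Matrix.transpose_mul, hCC', Matrix.transpose_one]
  have hT' : (C⁻¹)ᵀ * Cᵀ = 1 := by rw [← Matrix.transpose_mul, hCC, Matrix.transpose_one]
  have hι (γ) : iotaTilde σ₁ σ₂ N α γ =
      blkDiag C (C⁻¹)ᵀ * Mgam σ₁ σ₂ γ * blkDiag C⁻¹ Cᵀ := rfl
  set A := blkDiag C (C⁻¹)ᵀ
  set B := blkDiag C⁻¹ Cᵀ
  have hBA : B * A = 1 := by rw [blkDiag_mul, hCC', hT, blkDiag_one]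
  have hA : Aᵀ * J4 * A = J4 :=
    blkDiag_transpose_mul_J4_mul _ _ _ _ hT (by rw [Matrix.transpose_transpose, hCC'])
  have hB : Bᵀ * J4 * B = J4 :=
    blkDiag_transpose_mul_J4_mul _ _ _ _ hT' (by rw [Matrix.transpose_transpose, hCC])
  refine ⟨fun γ => ⟨exists_rat_eq_iotaTilde hα₀ h hgen γ.1, ?_⟩, fun γ δ => ?_, fun γ δ hγδ => ?_⟩
  · rw [hι]
    set M := Mgam σ₁ σ₂ γ.1
    have hM : Mᵀ * J4 * M = J4 := Mgam_transpose_mul_J4_mul σ₁ σ₂ γ.1 γ.2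
    calc (A * M * B)ᵀ * J4 * (A * M * B) = Bᵀ * (Mᵀ * (Aᵀ * J4 * A) * M) * B := by
          simp only [Matrix.transpose_mul, Matrix.mul_assoc]
      _ = J4 := by rw [hA, hM, hB]
  · rw [hι, hι, hι, Matrix.SpecialLinearGroup.coe_mul, Mgam_mul]
    set M := Mgam σ₁ σ₂ γ.1
    set M' := Mgam σ₁ σ₂ δ.1
    calc A * (M * M') * B = A * M * 1 * M' * B := by simp only [Matrix.mul_assoc, Matrix.one_mul]
      _ = A * M * B * (A * M' * B) := by rw [← hBA]; simp only [Matrix.mul_assoc]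
  · have hM (M : Matrix (Fin 4) (Fin 4) ℝ) : B * (A * M * B) * A = M := by
      calc B * (A * M * B) * A = (B * A) * M * (B * A) := by simp only [Matrix.mul_assoc]
        _ = M := by rw [hBA, Matrix.one_mul, Matrix.mul_one]
    apply Subtype.ext
    apply Mgam_injective σ₁ σ₂
    rw [← hM (Mgam σ₁ σ₂ γ.1), ← hM (Mgam σ₁ σ₂ δ.1), ← hι, ← hι]
    exact congrArg (fun X => B * X * A) hγδ
end
end

section
/- Let γ = (a b; c d) ∈ SL₂(F) and z₁, z₂ ∈ ℍ, and write ι̃(γ) in 2×2 blocks (A, B; C', D') (rational matrices). Then the matrix C'·ι(z₁,z₂) + D' is invertible and (A·ι(z₁,z₂) + B)·(C'·ι(z₁,z₂) + D')⁻¹ = ι( (σ₁(a)z₁ + σ₁(b))/(σ₁(c)z₁ + σ₁(d)), (σ₂(a)z₂ + σ₂(b))/(σ₂(c)z₂ + σ₂(d)) ); that is, the symplectic action of ι̃(γ) on the Siegel upper half space is compatible via ι with the componentwise Möbius action of γ on ℍ × ℍ through the two real embeddings of F. -/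
open Matrix

noncomputable section

/-- The `2 × 2` complex block of a real `4 × 4` matrix with row block index `r`
and column block index `c`. -/
def blk (g : Matrix (Fin 4) (Fin 4) ℝ) (r c : Fin 2) : Matrix (Fin 2) (Fin 2) ℂ :=
  Matrix.of fun i j =>
    ((g ⟨2 * r.1 + i.1, by have := r.2; have := i.2; omega⟩
        ⟨2 * c.1 + j.1, by have := c.2; have := j.2; omega⟩ : ℝ) : ℂ)

/-- The modular embedding `ι(z₁, z₂) = C · diag(z₁, z₂) · ᵀC`. -/
def iotaHP {F : Type*} [Field F] (σ₁ σ₂ : F →+* ℝ) (N : ℕ) (α : F)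
    (z₁ z₂ : ℂ) : Matrix (Fin 2) (Fin 2) ℂ :=
  (CmatQ σ₁ σ₂ N α).map Complex.ofReal * Matrix.diagonal ![z₁, z₂] *
    ((CmatQ σ₁ σ₂ N α).map Complex.ofReal)ᵀ

theorem blk_blkDiag_mul_Mgam_mul_blkDiag {F : Type*} [Field F] (σ₁ σ₂ : F →+* ℝ)
    (γ : Matrix (Fin 2) (Fin 2) F) (P : Fin 2 → Matrix (Fin 2) (Fin 2) ℝ)
    (Q : Fin 2 → Matrix (Fin 2) (Fin 2) ℝ) (r c : Fin 2) :
    blk (blkDiag (P 0) (P 1) * Mgam σ₁ σ₂ γ * blkDiag (Q 0) (Q 1)) r c =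
      (P r).map Complex.ofReal *
        diagonal ![(σ₁ (γ r c) : ℂ), (σ₂ (γ r c) : ℂ)] * (Q c).map Complex.ofReal := by
  ext i j
  fin_cases r <;> fin_cases c <;> fin_cases i <;> fin_cases j <;>
    simp [blk, blkDiag, Mgam, Matrix.mul_apply, Fin.sum_univ_succ, Matrix.diagonal,
      Matrix.of_apply]

theorem det_CmatQ_ne_zero {F : Type*} [Field F] {N : ℕ} (hN : 0 < N) {α : F}
    {σ₁ σ₂ : F →+* ℝ} (hσ₁ : σ₁ α = Real.sqrt N) (hσ₂ : σ₂ α = -Real.sqrt N) :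
    (CmatQ σ₁ σ₂ N α).det ≠ 0 := by
  have hpos : 0 < Real.sqrt N := Real.sqrt_pos.mpr (by exact_mod_cast hN)
  simp only [CmatQ, det_fin_two_of, wQ, sqrtDisc]
  split_ifs <;> simp only [map_div₀, map_add, map_mul, map_natCast, map_ofNat, hσ₁, hσ₂] <;>
    intro h <;> linarith

/-- The denominator of a Möbius transformation of determinant one does not vanish off the
real line. -/
theorem denom_ne_zero_of_det_eq_one {F : Type*} [Field F] (σ : F →+* ℝ)
    {γ : Matrix (Fin 2) (Fin 2) F} (hγ : γ.det = 1) {z : ℂ} (hz : z.im ≠ 0) :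
    (σ (γ 1 0) : ℂ) * z + (σ (γ 1 1) : ℂ) ≠ 0 := by
  intro h
  have him := congrArg Complex.im h
  have hre := congrArg Complex.re h
  simp [hz] at him
  simp [him] at hre
  rw [det_fin_two, him, hre] at hγ
  simp at hγ

/-- For `γ ∈ SL₂(F)` and `z₁, z₂ ∈ ℍ`, writing `ι̃(γ)` in `2 × 2` blocks
`(A, B; C', D')`, the matrix `C'·ι(z₁,z₂) + D'` is invertible and
`(A·ι(z₁,z₂) + B)·(C'·ι(z₁,z₂) + D')⁻¹ = ι(γ⟨z₁⟩_{σ₁}, γ⟨z₂⟩_{σ₂})`. -/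
theorem stmt9 {F : Type*} [Field F] [CharZero F] (N : ℕ) (hN : 1 < N)
    (hsf : Squarefree N) (α : F) (hα : α ^ 2 = (N : F))
    (hgen : ∀ x : F, ∃ p q : ℚ, x = (p : F) + (q : F) * α)
    (σ₁ σ₂ : F →+* ℝ) (hσ₁ : σ₁ α = Real.sqrt N) (hσ₂ : σ₂ α = -Real.sqrt N)
    (γ : Matrix (Fin 2) (Fin 2) F) (hγ : γ.det = 1)
    (z₁ z₂ : ℂ) (hz₁ : 0 < z₁.im) (hz₂ : 0 < z₂.im) :
    (blk (iotaTilde σ₁ σ₂ N α γ) 1 0 * iotaHP σ₁ σ₂ N α z₁ z₂ +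
        blk (iotaTilde σ₁ σ₂ N α γ) 1 1).det ≠ 0 ∧
    (blk (iotaTilde σ₁ σ₂ N α γ) 0 0 * iotaHP σ₁ σ₂ N α z₁ z₂ +
        blk (iotaTilde σ₁ σ₂ N α γ) 0 1) *
      (blk (iotaTilde σ₁ σ₂ N α γ) 1 0 * iotaHP σ₁ σ₂ N α z₁ z₂ +
        blk (iotaTilde σ₁ σ₂ N α γ) 1 1)⁻¹ =
      iotaHP σ₁ σ₂ N α
        (((σ₁ (γ 0 0) : ℂ) * z₁ + (σ₁ (γ 0 1) : ℂ)) /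
          ((σ₁ (γ 1 0) : ℂ) * z₁ + (σ₁ (γ 1 1) : ℂ)))
        (((σ₂ (γ 0 0) : ℂ) * z₂ + (σ₂ (γ 0 1) : ℂ)) /
          ((σ₂ (γ 1 0) : ℂ) * z₂ + (σ₂ (γ 1 1) : ℂ))) := by
  set K := (CmatQ σ₁ σ₂ N α).map Complex.ofReal with hK
  set L := ((CmatQ σ₁ σ₂ N α)⁻¹).map Complex.ofReal with hL
  have hdet := (det_CmatQ_ne_zero (by omega : 0 < N) hσ₁ hσ₂).isUnit
  have hLK : L * K = 1 := by
    have h := congrArg (fun X => X.map Complex.ofRealHom) (nonsing_inv_mul _ hdet)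
    simp only [Matrix.map_mul, Matrix.map_one _ (map_zero _) (map_one _)] at h
    exact h
  have hKLt : Kᵀ * Lᵀ = 1 := by rw [← transpose_mul, hLK, transpose_one]
  have hblk : ∀ r c, blk (iotaTilde σ₁ σ₂ N α γ) r c = (![K, Lᵀ] r) *
      diagonal ![(σ₁ (γ r c) : ℂ), (σ₂ (γ r c) : ℂ)] * (![L, Kᵀ] c) := by
    intro r c
    have h := blk_blkDiag_mul_Mgam_mul_blkDiag σ₁ σ₂ γ
      ![CmatQ σ₁ σ₂ N α, ((CmatQ σ₁ σ₂ N α)⁻¹)ᵀ] ![(CmatQ σ₁ σ₂ N α)⁻¹, (CmatQ σ₁ σ₂ N α)ᵀ] r c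
    refine h.trans ?_
    fin_cases r <;> fin_cases c <;> rfl
  have hrow : ∀ r, blk (iotaTilde σ₁ σ₂ N α γ) r 0 * iotaHP σ₁ σ₂ N α z₁ z₂ +
      blk (iotaTilde σ₁ σ₂ N α γ) r 1 = (![K, Lᵀ] r) *
        diagonal ![(σ₁ (γ r 0) : ℂ) * z₁ + (σ₁ (γ r 1) : ℂ),
          (σ₂ (γ r 0) : ℂ) * z₂ + (σ₂ (γ r 1) : ℂ)] * Kᵀ := by
    intro r
    have hdiag : diagonal ![(σ₁ (γ r 0) : ℂ) * z₁ + (σ₁ (γ r 1) : ℂ),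
        (σ₂ (γ r 0) : ℂ) * z₂ + (σ₂ (γ r 1) : ℂ)] =
        diagonal ![(σ₁ (γ r 0) : ℂ), (σ₂ (γ r 0) : ℂ)] * diagonal ![z₁, z₂] +
          diagonal ![(σ₁ (γ r 1) : ℂ), (σ₂ (γ r 1) : ℂ)] := by
      rw [diagonal_mul_diagonal, diagonal_add]
      congr 1
      ext i
      fin_cases i <;> rfl
    rw [hblk, hblk, hdiag, iotaHP, ← hK]
    simp only [cons_val_zero, cons_val_one, Matrix.mul_add, Matrix.add_mul, Matrix.mul_assoc]
    rw [← Matrix.mul_assoc L K, hLK, Matrix.one_mul]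
  have h₁ := denom_ne_zero_of_det_eq_one σ₁ hγ hz₁.ne'
  have h₂ := denom_ne_zero_of_det_eq_one σ₂ hγ hz₂.ne'
  have hden : (blk (iotaTilde σ₁ σ₂ N α γ) 1 0 * iotaHP σ₁ σ₂ N α z₁ z₂ +
      blk (iotaTilde σ₁ σ₂ N α γ) 1 1).det ≠ 0 := by
    have hd : Lᵀ.det * Kᵀ.det = 1 := by rw [mul_comm, ← det_mul, hKLt, det_one]
    have hd0 := hd.trans_ne one_ne_zero
    rw [hrow, det_mul, det_mul, det_diagonal, Fin.prod_univ_two]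
    exact mul_ne_zero (mul_ne_zero (left_ne_zero_of_mul hd0) (mul_ne_zero h₁ h₂))
      (right_ne_zero_of_mul hd0)
  refine ⟨hden, ?_⟩
  have hnum : blk (iotaTilde σ₁ σ₂ N α γ) 0 0 * iotaHP σ₁ σ₂ N α z₁ z₂ +
      blk (iotaTilde σ₁ σ₂ N α γ) 0 1 =
      iotaHP σ₁ σ₂ N α
        (((σ₁ (γ 0 0) : ℂ) * z₁ + (σ₁ (γ 0 1) : ℂ)) /
          ((σ₁ (γ 1 0) : ℂ) * z₁ + (σ₁ (γ 1 1) : ℂ)))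
        (((σ₂ (γ 0 0) : ℂ) * z₂ + (σ₂ (γ 0 1) : ℂ)) /
          ((σ₂ (γ 1 0) : ℂ) * z₂ + (σ₂ (γ 1 1) : ℂ))) *
      (blk (iotaTilde σ₁ σ₂ N α γ) 1 0 * iotaHP σ₁ σ₂ N α z₁ z₂ +
        blk (iotaTilde σ₁ σ₂ N α γ) 1 1) := by
    rw [hrow, hrow, iotaHP, ← hK]
    simp only [cons_val_zero, cons_val_one, Matrix.mul_assoc]
    rw [← Matrix.mul_assoc Kᵀ Lᵀ, hKLt, Matrix.one_mul, ← Matrix.mul_assoc (diagonal _) (diagonal _),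
      diagonal_mul_diagonal]
    congr 3
    ext i
    fin_cases i
    · exact (div_mul_cancel₀ _ h₁).symm
    · exact (div_mul_cancel₀ _ h₂).symm
  rw [hnum, mul_nonsing_inv_cancel_right _ _ hden.isUnit]
end
end

section
/- Let J be the 4×4 permutation matrix interchanging the second and fourth standard basis vectors (rows e₁, e₄, e₃, e₂), and for γ ∈ SL₂(F) set ι̃₀(γ) := J·ι̃(γ)·J⁻¹. Then for γ = (a b; c d) ∈ SL₂(F), the matrix ι̃₀(γ) has all entries in ℤ and all four entries of its lower left 2×2 block (rows 3,4 and columns 1,2) divisible by N, if and only if a, d ∈ 𝒪_F, b ∈ 𝔡⁻¹ and c ∈ 𝔡; i.e., ι̃₀(γ) satisfies the defining integrality and level-N congruence conditions of Γ₀^{(2)}(N) exactly when γ ∈ SL₂(𝒪_F ⊕ 𝔡). -/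
open Matrix

noncomputable section

/-- Membership in the ring of integers `𝒪_F = ℤ + ℤw`. -/
def InRingOfIntegers {F : Type*} [Field F] (N : ℕ) (α : F) (x : F) : Prop :=
  ∃ m n : ℤ, x = (m : F) + (n : F) * wQ N α

/-- Membership in the different ideal `𝔡 = √Δ · 𝒪_F`. -/
def InDifferent {F : Type*} [Field F] (N : ℕ) (α : F) (x : F) : Prop :=
  ∃ m n : ℤ, x = sqrtDisc N α * ((m : F) + (n : F) * wQ N α)

/-- Membership in the inverse different `𝔡⁻¹ = (1/√Δ) · 𝒪_F`. -/
def InInvDifferent {F : Type*} [Field F] (N : ℕ) (α : F) (x : F) : Prop :=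
  ∃ m n : ℤ, x = ((m : F) + (n : F) * wQ N α) / sqrtDisc N α

/-- The permutation matrix `J` interchanging the second and fourth standard basis
vectors. -/
def Jswap : Matrix (Fin 4) (Fin 4) ℝ :=
  !![1, 0, 0, 0;
     0, 0, 0, 1;
     0, 0, 1, 0;
     0, 1, 0, 0]

/-- The conjugated embedding `ι̃₀(γ) = J · ι̃(γ) · J⁻¹`. -/
def iotaTilde0 {F : Type*} [Field F] (σ₁ σ₂ : F →+* ℝ) (N : ℕ) (α : F)
    (γ : Matrix (Fin 2) (Fin 2) F) : Matrix (Fin 4) (Fin 4) ℝ :=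
  Jswap * iotaTilde σ₁ σ₂ N α γ * Jswap⁻¹

/-- Explicit entries of `ι̃₀(γ)`, where `s = σ₁(w) - σ₂(w)`. -/
theorem iotaTilde0_eq {F : Type*} [Field F] (σ₁ σ₂ : F →+* ℝ) (N : ℕ) (α : F)
    (γ : Matrix (Fin 2) (Fin 2) F) {u v s a a' b b' c c' d d' : ℝ}
    (hu : σ₁ (wQ N α) = u) (hv : σ₂ (wQ N α) = v) (hs : u - v = s) (hs0 : s ≠ 0)
    (ha : σ₁ (γ 0 0) = a) (ha' : σ₂ (γ 0 0) = a') (hb : σ₁ (γ 0 1) = b) (hb' : σ₂ (γ 0 1) = b')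
    (hc : σ₁ (γ 1 0) = c) (hc' : σ₂ (γ 1 0) = c') (hd : σ₁ (γ 1 1) = d) (hd' : σ₂ (γ 1 1) = d') :
    iotaTilde0 σ₁ σ₂ N α γ =
      !![(a' * u - a * v) / s, b * u + b' * v, b + b', (a - a') / s;
         -(c * v + c' * u) / s ^ 2, (d * u - d' * v) / s, (d - d') / s, (c + c') / s ^ 2;
         (c * v ^ 2 + c' * u ^ 2) / s ^ 2, u * v * (d' - d) / s, (d' * u - d * v) / s,
           -(c * v + c' * u) / s ^ 2;
         u * v * (a' - a) / s, b * u ^ 2 + b' * v ^ 2, b * u + b' * v, (a * u - a' * v) / s] := by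
  have hJ : Jswap⁻¹ = Jswap := by
    apply Matrix.inv_eq_left_inv
    ext i j
    fin_cases i <;> fin_cases j <;> simp [Jswap, Matrix.mul_apply, Fin.sum_univ_four]
  have hC : (CmatQ σ₁ σ₂ N α)⁻¹ = !![-v / s, 1 / s; u / s, -1 / s] := by
    apply Matrix.inv_eq_left_inv
    rw [CmatQ, hu, hv]
    ext i j
    fin_cases i <;> fin_cases j <;>
      simp [Matrix.mul_apply, Fin.sum_univ_two] <;> field_simp <;> linarith
  rw [iotaTilde0, iotaTilde, hJ, hC, CmatQ, Mgam, hu, hv, ha, ha', hb, hb', hc, hc', hd, hd']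
  ext i j
  fin_cases i <;> fin_cases j <;>
    simp [Jswap, blkDiag, Matrix.mul_apply, Fin.sum_univ_four] <;> field_simp <;> ring

theorem natCast_dvd_discN (N : ℕ) : ∃ l : ℤ, (discN N : ℤ) = N * l := by
  unfold discN
  split_ifs
  · exact ⟨1, by simp⟩
  · exact ⟨4, by push_cast; ring⟩

/-- `N` divides the norm `(Δ² - Δ) / 4` of `w`. -/
theorem natCast_dvd_norm_wQ (N : ℕ) :
    ∃ k : ℤ, (discN N : ℤ) ^ 2 - discN N = 4 * (N * k) := by
  unfold discN
  split_ifs with h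
  · obtain ⟨q, hq⟩ : ∃ q : ℤ, (N : ℤ) = 4 * q + 1 := ⟨(N : ℤ) / 4, by omega⟩
    exact ⟨q, by linear_combination (N : ℤ) * hq⟩
  · exact ⟨4 * N - 1, by push_cast; ring⟩

theorem map_wQ {F : Type*} [Field F] (σ : F →+* ℝ) (N : ℕ) (α : F) :
    σ (wQ N α) = (discN N + σ (sqrtDisc N α)) / 2 := by
  simp [wQ, map_ofNat]

theorem map_sqrtDisc_sq {F : Type*} [Field F] (σ : F →+* ℝ) (N : ℕ) (α : F)
    (hα : α ^ 2 = (N : F)) : σ (sqrtDisc N α) ^ 2 = discN N := by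
  have h : sqrtDisc N α ^ 2 = (discN N : F) := by
    unfold sqrtDisc discN
    split_ifs
    · exact hα
    · push_cast
      linear_combination 4 * hα
  rw [← map_pow, h, map_natCast]

theorem map_sqrtDisc_conj {F : Type*} [Field F] (σ₁ σ₂ : F →+* ℝ) (N : ℕ) (α : F)
    (h : σ₂ α = -σ₁ α) : σ₂ (sqrtDisc N α) = -σ₁ (sqrtDisc N α) := by
  unfold sqrtDisc
  split_ifs
  · exact h
  · simp [h, map_ofNat]

theorem discN_pos {N : ℕ} (hN : 0 < N) : 0 < discN N := by
  unfold discN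
  split_ifs <;> omega

/-- For `γ = (a b; c d) ∈ SL₂(F)`, the matrix `ι̃₀(γ)` has integral entries with
lower left `2 × 2` block divisible by `N` (i.e. satisfies the defining conditions
of `Γ₀^{(2)}(N)`) if and only if `a, d ∈ 𝒪_F`, `b ∈ 𝔡⁻¹` and `c ∈ 𝔡`, i.e.
`γ ∈ SL₂(𝒪_F ⊕ 𝔡)`. -/
theorem stmt10 {F : Type*} [Field F] [CharZero F] (N : ℕ) (hN : 1 < N)
    (hsf : Squarefree N) (α : F) (hα : α ^ 2 = (N : F))
    (hgen : ∀ x : F, ∃ p q : ℚ, x = (p : F) + (q : F) * α)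
    (σ₁ σ₂ : F →+* ℝ) (hσ₁ : σ₁ α = Real.sqrt N) (hσ₂ : σ₂ α = -Real.sqrt N)
    (γ : Matrix (Fin 2) (Fin 2) F) (hγ : γ.det = 1) :
    ((∀ i j, ∃ m : ℤ, iotaTilde0 σ₁ σ₂ N α γ i j = (m : ℝ)) ∧
      (∀ i j : Fin 2,
        ∃ m : ℤ, iotaTilde0 σ₁ σ₂ N α γ
            ⟨2 + i.1, by have := i.2; omega⟩ ⟨j.1, by have := j.2; omega⟩ =
          (N : ℝ) * (m : ℝ))) ↔
    (InRingOfIntegers N α (γ 0 0) ∧ InRingOfIntegers N α (γ 1 1) ∧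
      InInvDifferent N α (γ 0 1) ∧ InDifferent N α (γ 1 0)) := by
  obtain ⟨l, hl⟩ := natCast_dvd_discN N
  obtain ⟨k, hk⟩ := natCast_dvd_norm_wQ N
  have hss := map_sqrtDisc_sq σ₁ N α hα
  have hs' := map_sqrtDisc_conj σ₁ σ₂ N α (by rw [hσ₁, hσ₂])
  have hu := map_wQ σ₁ N α
  have hv := map_wQ σ₂ N α
  rw [hs'] at hv
  have hD : (0 : ℝ) < discN N := by exact_mod_cast discN_pos (by omega : 0 < N)
  have hlR : (discN N : ℝ) = N * l := by exact_mod_cast hl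
  have hkR : (discN N : ℝ) ^ 2 - discN N = 4 * (N * k) := by exact_mod_cast hk
  obtain ⟨s, hs⟩ : ∃ s, σ₁ (sqrtDisc N α) = s := ⟨_, rfl⟩
  obtain ⟨D, hDD⟩ : ∃ D : ℤ, (discN N : ℤ) = D := ⟨_, rfl⟩
  have hDR : (discN N : ℝ) = D := by exact_mod_cast hDD
  rw [hs] at hss hs' hu hv
  rw [hDR] at hss hu hv hD hlR hkR
  have hs0 : s ≠ 0 := by
    rintro rfl
    norm_num at hss
    linarith
  rw [iotaTilde0_eq σ₁ σ₂ N α γ hu hv (by ring) hs0 rfl rfl rfl rfl rfl rfl rfl rfl]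
  constructor
  · rintro ⟨h, -⟩
    refine ⟨?_, ?_, ?_, ?_⟩
    · obtain ⟨m, hm⟩ := h 0 0
      obtain ⟨n, hn⟩ := h 0 3
      refine ⟨m, n, σ₁.injective ?_⟩
      simp at hm hn
      simp only [map_add, map_mul, map_intCast, hu, ← hm, ← hn]
      field_simp
      ring
    · obtain ⟨m, hm⟩ := h 2 2
      obtain ⟨n, hn⟩ := h 1 2
      refine ⟨m, n, σ₁.injective ?_⟩
      simp at hm hn
      simp only [map_add, map_mul, map_intCast, hu, ← hm, ← hn]
      field_simp
      ring
    · obtain ⟨m, hm⟩ := h 0 1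
      obtain ⟨n, hn⟩ := h 0 2
      refine ⟨m - n * D, n, σ₁.injective ?_⟩
      simp at hm hn
      simp only [map_add, map_sub, map_div₀, map_mul, map_intCast, hu, hs, Int.cast_sub,
        Int.cast_mul, ← hm, ← hn]
      field_simp
      ring
    · obtain ⟨m, hm⟩ := h 2 3
      obtain ⟨n, hn⟩ := h 1 3
      refine ⟨m, n, σ₁.injective ?_⟩
      simp at hm hn
      simp only [map_add, map_mul, map_intCast, hu, hs, ← hm, ← hn]
      field_simp
      ring
  · rintro ⟨⟨am, an, ha⟩, ⟨dm, dn, hd⟩, ⟨bm, bn, hb⟩, ⟨cm, cn, hc⟩⟩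
    have hDuv : (D : ℝ) = (D + s) / 2 + (D + -s) / 2 := by ring
    have hkuv : (N * k : ℝ) = (D + s) / 2 * ((D + -s) / 2) := by linarith
    have hsuv : s = (D + s) / 2 - (D + -s) / 2 := by ring
    generalize (D + s) / 2 = u at *
    generalize (D + -s) / 2 = v at *
    have hint : !![(σ₂ (γ 0 0) * u - σ₁ (γ 0 0) * v) / s, σ₁ (γ 0 1) * u + σ₂ (γ 0 1) * v,
          σ₁ (γ 0 1) + σ₂ (γ 0 1), (σ₁ (γ 0 0) - σ₂ (γ 0 0)) / s;
        -(σ₁ (γ 1 0) * v + σ₂ (γ 1 0) * u) / s ^ 2, (σ₁ (γ 1 1) * u - σ₂ (γ 1 1) * v) / s,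
          (σ₁ (γ 1 1) - σ₂ (γ 1 1)) / s, (σ₁ (γ 1 0) + σ₂ (γ 1 0)) / s ^ 2;
        (σ₁ (γ 1 0) * v ^ 2 + σ₂ (γ 1 0) * u ^ 2) / s ^ 2,
          u * v * (σ₂ (γ 1 1) - σ₁ (γ 1 1)) / s, (σ₂ (γ 1 1) * u - σ₁ (γ 1 1) * v) / s,
          -(σ₁ (γ 1 0) * v + σ₂ (γ 1 0) * u) / s ^ 2;
        u * v * (σ₂ (γ 0 0) - σ₁ (γ 0 0)) / s, σ₁ (γ 0 1) * u ^ 2 + σ₂ (γ 0 1) * v ^ 2,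
          σ₁ (γ 0 1) * u + σ₂ (γ 0 1) * v, (σ₁ (γ 0 0) * u - σ₂ (γ 0 0) * v) / s] =
        (!![am, bm + bn * D, bn, an;
          cm, dm + dn * D, dn, cn;
          N * (-cm * l - cn * k), N * (-dn * k), dm, cm;
          N * (-an * k), N * (bm * l + bn * (l * D - k)), bm + bn * D, am + an * D] :
          Matrix (Fin 4) (Fin 4) ℤ).map (Int.cast : ℤ → ℝ) := by
      have hlD : (N * l : ℝ) = u + v := hlR.symm.trans hDuv
      have hc0 : (N * (-cm * l - cn * k) : ℝ) = -cm * (u + v) - cn * (u * v) := by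
        linear_combination -cm * hlD - cn * hkuv
      have hd0 : (N * (-dn * k) : ℝ) = -dn * (u * v) := by linear_combination -dn * hkuv
      have ha0 : (N * (-an * k) : ℝ) = -an * (u * v) := by linear_combination -an * hkuv
      have hb0 : (N * (bm * l + bn * (l * (u + v) - k)) : ℝ) =
          bm * (u + v) + bn * ((u + v) * (u + v) - u * v) := by
        linear_combination (bm + bn * (u + v)) * hlD - bn * hkuv
      subst hsuv
      ext i j
      fin_cases i <;> fin_cases j <;>
        simp only [ha, hb, hc, hd, map_add, map_mul, map_div₀, map_intCast, hu, hv, hs, hs',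
          Matrix.map_apply, Matrix.of_apply, Matrix.cons_val', Matrix.cons_val, Fin.reduceFinMk,
          Fin.zero_eta, Fin.mk_one, Fin.isValue, Matrix.cons_val_zero, Matrix.cons_val_one,
          Int.cast_add, Int.cast_mul, Int.cast_sub, Int.cast_neg, Int.cast_natCast, hDuv, ha0,
          hb0, hc0, hd0] <;>
        field_simp <;> ring
    rw [hint]
    refine ⟨fun i j => ⟨_, rfl⟩, fun i j => ?_⟩
    fin_cases i <;> fin_cases j <;> exact ⟨_, (Int.cast_mul _ _).trans (congrArg (· * _) (Int.cast_natCast N))⟩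
end
end

section
/- K := {x₁ + w·x₂ : x₁ ∈ L, x₂ ∈ L^#} is an 𝒪_F-submodule of V ⊗_ℚ F, and the extended quadratic form takes integral values on it: q_F(y) ∈ 𝒪_F for every y ∈ K. -/
open scoped TensorProduct

noncomputable section

/-- The dual lattice `L^# = {y ∈ V : B(y, L) ⊆ ℤ}`. -/
def dualLat {V : Type*} [AddCommGroup V] [Module ℚ V] (Q : QuadraticForm ℚ V)
    (L : Submodule ℤ V) : Set V :=
  {y | ∀ x ∈ L, ∃ m : ℤ, QuadraticMap.polar (⇑Q) y x = (m : ℚ)}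

/-- The `𝒪_F`-lattice `K = {x₁ + w·x₂ : x₁ ∈ L, x₂ ∈ L^#}` inside `F ⊗_ℚ V`. -/
def Klat {F : Type*} [Field F] [CharZero F] (N : ℕ) (α : F) {V : Type*}
    [AddCommGroup V] [Module ℚ V] (Q : QuadraticForm ℚ V) (L : Submodule ℤ V) :
    Set (F ⊗[ℚ] V) :=
  {y | ∃ x₁ ∈ L, ∃ x₂ ∈ dualLat Q L, y = (1 : F) ⊗ₜ[ℚ] x₁ + wQ N α ⊗ₜ[ℚ] x₂}

theorem exists_wQ_sq {F : Type*} [Field F] [CharZero F] (N : ℕ) (α : F)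
    (hα : α ^ 2 = (N : F)) :
    ∃ j k : ℤ, wQ N α * wQ N α = ((j * N : ℤ) : F) * wQ N α + ((k * N : ℤ) : F) := by
  unfold wQ discN sqrtDisc
  split_ifs with h
  · obtain ⟨t, ht⟩ : ∃ t : ℕ, N = 4 * t + 1 := ⟨N / 4, by omega⟩
    refine ⟨1, -t, ?_⟩
    have ht' : (N : F) = 4 * t + 1 := by exact_mod_cast ht
    push_cast
    linear_combination (1 / 4 : F) * hα - (N : F) / 4 * ht'
  · refine ⟨4, -(4 * N - 1), ?_⟩
    push_cast
    linear_combination hα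

section dualLat

variable {V : Type*} [AddCommGroup V] [Module ℚ V] (Q : QuadraticForm ℚ V) (L : Submodule ℤ V)

theorem zero_mem_dualLat : (0 : V) ∈ dualLat Q L :=
  fun x _ => ⟨0, by simp⟩

variable {Q L}

theorem add_mem_dualLat {y z : V} (hy : y ∈ dualLat Q L) (hz : z ∈ dualLat Q L) :
    y + z ∈ dualLat Q L := by
  intro x hx
  obtain ⟨m, hm⟩ := hy x hx
  obtain ⟨n, hn⟩ := hz x hx
  exact ⟨m + n, by rw [QuadraticMap.polar_add_left, hm, hn]; push_cast; rfl⟩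

theorem zsmul_mem_dualLat (c : ℤ) {y : V} (hy : y ∈ dualLat Q L) :
    c • y ∈ dualLat Q L := by
  intro x hx
  obtain ⟨m, hm⟩ := hy x hx
  refine ⟨c * m, ?_⟩
  rw [← Int.cast_smul_eq_zsmul ℚ c y, QuadraticMap.polar_smul_left, hm]
  push_cast
  rfl

theorem mem_dualLat_of_mem (hint : ∀ x ∈ L, ∃ m : ℤ, Q x = (m : ℚ)) {y : V} (hy : y ∈ L) :
    y ∈ dualLat Q L := by
  intro x hx
  obtain ⟨a, ha⟩ := hint (y + x) (L.add_mem hy hx)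
  obtain ⟨b, hb⟩ := hint y hy
  obtain ⟨c, hc⟩ := hint x hx
  exact ⟨a - b - c, by rw [QuadraticMap.polar, ha, hb, hc]; push_cast; rfl⟩

end dualLat

section baseChange

variable {F : Type*} [Field F] [CharZero F] {V : Type*} [AddCommGroup V] [Module ℚ V]

theorem tmul_zsmul_eq (a : F) (c : ℤ) (x : V) :
    a ⊗ₜ[ℚ] (c • x) = ((c : F) * a) ⊗ₜ[ℚ] x := by
  rw [TensorProduct.tmul_smul, TensorProduct.smul_tmul', zsmul_eq_mul]

theorem baseChange_one_tmul_add_tmul (Q : QuadraticForm ℚ V) (w : F) (x y : V) :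
    Q.baseChange F ((1 : F) ⊗ₜ[ℚ] x + w ⊗ₜ[ℚ] y) =
      (Q x : F) + w * w * (Q y : F) + w * ((QuadraticMap.polar Q y x : ℚ) : F) := by
  have hpolar := LinearMap.congr_fun₂ (QuadraticForm.polarBilin_baseChange (A := F) Q)
    ((1 : F) ⊗ₜ[ℚ] x) (w ⊗ₜ[ℚ] y)
  rw [QuadraticMap.map_add (Q.baseChange F)]
  rw [QuadraticMap.polarBilin_apply_apply] at hpolar
  rw [hpolar]
  simp [QuadraticMap.polar_comm Q x y, Algebra.smul_def]
  ring

end baseChange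

/-- `K = {x₁ + w·x₂ : x₁ ∈ L, x₂ ∈ L^#}` is an `𝒪_F`-submodule of `V ⊗_ℚ F`, and
the base extension `q_F` of `q` takes values in `𝒪_F = ℤ + ℤw` on `K`. -/
theorem stmt11 {F : Type*} [Field F] [CharZero F] (N : ℕ) (hN : 1 < N)
    (hsf : Squarefree N) (α : F) (hα : α ^ 2 = (N : F))
    (hgen : ∀ x : F, ∃ p q : ℚ, x = (p : F) + (q : F) * α)
    {V : Type*} [AddCommGroup V] [Module ℚ V] [FiniteDimensional ℚ V]
    (Q : QuadraticForm ℚ V) (hQpos : QuadraticMap.PosDef Q)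
    (L : Submodule ℤ V) (hfull : Submodule.span ℚ (L : Set V) = ⊤)
    (hint : ∀ x ∈ L, ∃ m : ℤ, Q x = (m : ℚ))
    (hNdual : ∀ y ∈ dualLat Q L, ∃ m : ℤ, (N : ℚ) * Q y = (m : ℚ))
    (hsub : ∀ y ∈ dualLat Q L, ∃ x ∈ L, y = (N : ℚ)⁻¹ • x) :
    (0 : F ⊗[ℚ] V) ∈ Klat N α Q L ∧
    (∀ y ∈ Klat N α Q L, ∀ z ∈ Klat N α Q L, y + z ∈ Klat N α Q L) ∧
    (∀ c : F, (∃ m n : ℤ, c = (m : F) + (n : F) * wQ N α) →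
      ∀ y ∈ Klat N α Q L, c • y ∈ Klat N α Q L) ∧
    (∀ y ∈ Klat N α Q L,
      ∃ m n : ℤ, Q.baseChange F y = (m : F) + (n : F) * wQ N α) := by
  obtain ⟨j, k, hw⟩ := exists_wQ_sq N α hα
  have hNsmul : ∀ y ∈ dualLat Q L, (N : ℤ) • y ∈ L := by
    intro y hy
    obtain ⟨x, hx, rfl⟩ := hsub y hy
    have hN0 : (N : ℚ) ≠ 0 := by exact_mod_cast (by omega : N ≠ 0)
    rwa [← Int.cast_smul_eq_zsmul ℚ, Int.cast_natCast, smul_inv_smul₀ hN0]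
  refine ⟨⟨0, L.zero_mem, 0, zero_mem_dualLat Q L, by simp⟩, ?_, ?_, ?_⟩
  · rintro _ ⟨x₁, hx₁, x₂, hx₂, rfl⟩ _ ⟨y₁, hy₁, y₂, hy₂, rfl⟩
    refine ⟨x₁ + y₁, L.add_mem hx₁ hy₁, x₂ + y₂, add_mem_dualLat hx₂ hy₂, ?_⟩
    simp only [TensorProduct.tmul_add]
    abel
  · rintro _ ⟨m, n, rfl⟩ _ ⟨x₁, hx₁, x₂, hx₂, rfl⟩
    refine ⟨m • x₁ + (n * k) • ((N : ℤ) • x₂),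
      L.add_mem (L.smul_mem _ hx₁) (L.smul_mem _ (hNsmul x₂ hx₂)),
      n • x₁ + (m + n * (j * N)) • x₂,
      add_mem_dualLat (zsmul_mem_dualLat n (mem_dualLat_of_mem hint hx₁))
        (zsmul_mem_dualLat _ hx₂), ?_⟩
    have hcoeff : (m + n * wQ N α) * wQ N α =
        ((N : ℤ) : F) * ((n * k : ℤ) : F) + ((m + n * (j * N) : ℤ) : F) * wQ N α := by
      push_cast at hw ⊢
      linear_combination (n : F) * hw
    simp only [TensorProduct.tmul_add, tmul_zsmul_eq, smul_add, TensorProduct.smul_tmul',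
      smul_eq_mul, hcoeff, TensorProduct.add_tmul, mul_one]
    abel
  · rintro _ ⟨x₁, hx₁, x₂, hx₂, rfl⟩
    obtain ⟨a, ha⟩ := hint x₁ hx₁
    obtain ⟨b, hb⟩ := hx₂ x₁ hx₁
    obtain ⟨c, hc⟩ := hNdual x₂ hx₂
    refine ⟨a + k * c, b + j * c, ?_⟩
    have hc' : (N : F) * (Q x₂ : F) = (c : F) := by exact_mod_cast congrArg (Rat.cast : ℚ → F) hc
    rw [baseChange_one_tmul_add_tmul, ha, hb]
    push_cast at hw ⊢
    linear_combination (Q x₂ : F) * hw + ((j : F) * wQ N α + k) * hc'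
end
end
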